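/- There exist ε₀ > 0 and C > 0 with the following property. Let 0 < ε ≤ ε₀ and let η: ℝ → ℝ be a C^∞, even, 2π-periodic function with sup_{x∈ℝ} |η^{(j)}(x)| ≤ ε for all 0 ≤ j ≤ 5. Let Ω = {x+iy ∈ ℂ : y < η(x)}. Then there exists a function Z = Z₁ + iZ₂ : closure(Ω) → ℂ, continuous on closure(Ω) and holomorphic on Ω, such that: (i) Z restricted to Ω is a bijection from Ω onto the open lower half-plane {w ∈ ℂ : Im w < 0}; (ii) Z₂(x + iη(x)) = 0 for all x ∈ ℝ; (iii) Z(z + 2π) = Z(z) + 2π for all z ∈ Ω (so Z₁(x+2π,y) = 2π + Z₁(x,y) and Z₂(x+2π,y) = Z₂(x,y)); (iv) Z(−conj(z)) = −conj(Z(z)) for all z ∈ Ω (so Z₁ is odd in x and Z₂ is even in x); (v) sup over Ω of |∇(Z₁ − x)| + |∇(Z₂ − y)| ≤ C·ε. -/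

import Mathlib

open Complex Set

noncomputable section

/-- The fluid domain `Ω = {x+iy : y < η(x)}` below the surface `y = η(x)`. -/
def fluidDomain (η : ℝ → ℝ) : Set ℂ := {z : ℂ | z.im < η z.re}

/-- The coefficient of `cos ((j + 1) x)` in the cosine series of `φ` on `[0, π]`. -/
def cosCoeff (φ : ℝ → ℝ) (j : ℕ) : ℝ :=
  2 / Real.pi * ∫ x in (0 : ℝ)..Real.pi, φ x * Real.cos ((j + 1 : ℝ) * x)

/-- The sine polynomial of degree `n` with coefficients `a`. -/
def sinPoly (a : ℕ → ℝ) (n : ℕ) (x : ℝ) : ℝ :=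
  ∑ j ∈ Finset.range n, a j * Real.sin ((j + 1 : ℝ) * x)

lemma integral_cos_int_mul (m : ℤ) :
    ∫ x in (0 : ℝ)..Real.pi, Real.cos (m * x) = if m = 0 then Real.pi else 0 := by
  split_ifs with h
  · simp [h]
  · have hm : (m : ℝ) ≠ 0 := by exact_mod_cast h
    rw [intervalIntegral.integral_comp_mul_left (fun x => Real.cos x) hm]
    simp [Real.sin_int_mul_pi]

lemma integral_cos_mul_cos (i j : ℕ) :
    ∫ x in (0 : ℝ)..Real.pi, Real.cos ((i + 1 : ℝ) * x) * Real.cos ((j + 1 : ℝ) * x) =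
      if i = j then Real.pi / 2 else 0 := by
  have h : ∀ x : ℝ, Real.cos ((i + 1 : ℝ) * x) * Real.cos ((j + 1 : ℝ) * x) =
      (Real.cos (((i - j : ℤ) : ℝ) * x) + Real.cos (((i + j + 2 : ℤ) : ℝ) * x)) / 2 := by
    intro x
    have h1 : ((i - j : ℤ) : ℝ) * x = (i + 1 : ℝ) * x - (j + 1 : ℝ) * x := by push_cast; ring
    have h2 : ((i + j + 2 : ℤ) : ℝ) * x = (i + 1 : ℝ) * x + (j + 1 : ℝ) * x := by
      push_cast; ring
    rw [h1, h2, Real.cos_add, Real.cos_sub]; ring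
  simp_rw [h]
  rw [intervalIntegral.integral_div, intervalIntegral.integral_add
    (Continuous.intervalIntegrable (by fun_prop) _ _)
    (Continuous.intervalIntegrable (by fun_prop) _ _), integral_cos_int_mul,
    integral_cos_int_mul, if_neg (by omega : ¬ ((i : ℤ) + j + 2 = 0)), add_zero]
  by_cases hij : i = j
  · simp [hij]
  · rw [if_neg (by omega), if_neg hij]; simp

lemma integral_sin_mul_sin (i j : ℕ) :
    ∫ x in (0 : ℝ)..Real.pi, Real.sin ((i + 1 : ℝ) * x) * Real.sin ((j + 1 : ℝ) * x) =
      if i = j then Real.pi / 2 else 0 := by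
  have h : ∀ x : ℝ, Real.sin ((i + 1 : ℝ) * x) * Real.sin ((j + 1 : ℝ) * x) =
      (Real.cos (((i - j : ℤ) : ℝ) * x) - Real.cos (((i + j + 2 : ℤ) : ℝ) * x)) / 2 := by
    intro x
    have h1 : ((i - j : ℤ) : ℝ) * x = (i + 1 : ℝ) * x - (j + 1 : ℝ) * x := by push_cast; ring
    have h2 : ((i + j + 2 : ℤ) : ℝ) * x = (i + 1 : ℝ) * x + (j + 1 : ℝ) * x := by
      push_cast; ring
    rw [h1, h2, Real.cos_add, Real.cos_sub]; ring
  simp_rw [h]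
  rw [intervalIntegral.integral_div, intervalIntegral.integral_sub
    (Continuous.intervalIntegrable (by fun_prop) _ _)
    (Continuous.intervalIntegrable (by fun_prop) _ _), integral_cos_int_mul,
    integral_cos_int_mul, if_neg (by omega : ¬ ((i : ℤ) + j + 2 = 0)), sub_zero]
  by_cases hij : i = j
  · simp [hij]
  · rw [if_neg (by omega), if_neg hij]; simp

lemma integral_sinPoly_sq (a : ℕ → ℝ) (n : ℕ) :
    ∫ x in (0 : ℝ)..Real.pi, sinPoly a n x ^ 2 =
      Real.pi / 2 * ∑ j ∈ Finset.range n, a j ^ 2 := by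
  have h : ∀ x, sinPoly a n x ^ 2 = ∑ i ∈ Finset.range n, ∑ j ∈ Finset.range n,
      a i * a j * (Real.sin ((i + 1 : ℝ) * x) * Real.sin ((j + 1 : ℝ) * x)) := by
    intro x
    rw [sinPoly, sq, Finset.sum_mul_sum]
    exact Finset.sum_congr rfl fun i _ => Finset.sum_congr rfl fun j _ => by ring
  simp_rw [h]
  rw [intervalIntegral.integral_finsetSum
    fun i _ => Continuous.intervalIntegrable (by fun_prop) _ _, Finset.mul_sum]
  refine Finset.sum_congr rfl fun i hi => ?_
  rw [intervalIntegral.integral_finsetSum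
    fun i _ => Continuous.intervalIntegrable (by fun_prop) _ _]
  simp_rw [intervalIntegral.integral_const_mul, integral_sin_mul_sin]
  simp only [mul_ite, mul_zero, Finset.sum_ite_eq, hi, if_true]
  ring

/-- Bessel's inequality for the cosine coefficients. -/
lemma sum_cosCoeff_sq_le {φ : ℝ → ℝ} (hφ : Continuous φ) (n : ℕ) :
    Real.pi / 2 * ∑ j ∈ Finset.range n, cosCoeff φ j ^ 2 ≤
      ∫ x in (0 : ℝ)..Real.pi, φ x ^ 2 := by
  have hcoef : ∀ j : ℕ, ∫ x in (0 : ℝ)..Real.pi, φ x * Real.cos ((j + 1 : ℝ) * x) =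
      Real.pi / 2 * cosCoeff φ j := by
    intro j
    rw [cosCoeff]
    field_simp
  have h0 : 0 ≤ ∫ x in (0 : ℝ)..Real.pi, (φ x -
      ∑ j ∈ Finset.range n, cosCoeff φ j * Real.cos ((j + 1 : ℝ) * x)) ^ 2 :=
    intervalIntegral.integral_nonneg Real.pi_pos.le fun x _ => sq_nonneg _
  have h : ∀ x, (φ x - ∑ j ∈ Finset.range n, cosCoeff φ j * Real.cos ((j + 1 : ℝ) * x)) ^ 2 =
      φ x ^ 2 - 2 * ∑ j ∈ Finset.range n, cosCoeff φ j * (φ x * Real.cos ((j + 1 : ℝ) * x)) +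
      ∑ i ∈ Finset.range n, ∑ j ∈ Finset.range n, cosCoeff φ i * cosCoeff φ j *
        (Real.cos ((i + 1 : ℝ) * x) * Real.cos ((j + 1 : ℝ) * x)) := by
    intro x
    rw [sub_sq, sq (Finset.sum _ _), Finset.sum_mul_sum]
    congr 1
    · rw [mul_assoc, Finset.mul_sum]
      congr 2
      exact Finset.sum_congr rfl fun i _ => by ring
    · exact Finset.sum_congr rfl fun i _ => Finset.sum_congr rfl fun j _ => by ring
  simp_rw [h] at h0
  rw [intervalIntegral.integral_add (Continuous.intervalIntegrable (by fun_prop) _ _)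
    (Continuous.intervalIntegrable (by fun_prop) _ _), intervalIntegral.integral_sub
    (Continuous.intervalIntegrable (by fun_prop) _ _)
    (Continuous.intervalIntegrable (by fun_prop) _ _), intervalIntegral.integral_const_mul,
    intervalIntegral.integral_finsetSum
    fun i _ => Continuous.intervalIntegrable (by fun_prop) _ _,
    intervalIntegral.integral_finsetSum
    fun i _ => Continuous.intervalIntegrable (by fun_prop) _ _] at h0
  have h2 : ∑ i ∈ Finset.range n, ∫ x in (0 : ℝ)..Real.pi, ∑ j ∈ Finset.range n,
      cosCoeff φ i * cosCoeff φ j *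
        (Real.cos ((i + 1 : ℝ) * x) * Real.cos ((j + 1 : ℝ) * x)) =
      Real.pi / 2 * ∑ j ∈ Finset.range n, cosCoeff φ j ^ 2 := by
    rw [Finset.mul_sum]
    refine Finset.sum_congr rfl fun i hi => ?_
    rw [intervalIntegral.integral_finsetSum
      fun i _ => Continuous.intervalIntegrable (by fun_prop) _ _]
    simp_rw [intervalIntegral.integral_const_mul, integral_cos_mul_cos]
    simp only [mul_ite, mul_zero, Finset.sum_ite_eq, hi, if_true]
    ring
  have h1 : ∑ i ∈ Finset.range n, ∫ x in (0 : ℝ)..Real.pi,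
      cosCoeff φ i * (φ x * Real.cos ((i + 1 : ℝ) * x)) =
      Real.pi / 2 * ∑ j ∈ Finset.range n, cosCoeff φ j ^ 2 := by
    rw [Finset.mul_sum]
    refine Finset.sum_congr rfl fun i _ => ?_
    rw [intervalIntegral.integral_const_mul, hcoef]
    ring
  rw [h1, h2] at h0
  linarith

lemma cosCoeff_sub {φ ψ : ℝ → ℝ} (hφ : Continuous φ) (hψ : Continuous ψ) (j : ℕ) :
    cosCoeff (fun x => φ x - ψ x) j = cosCoeff φ j - cosCoeff ψ j := by
  simp only [cosCoeff, sub_mul]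
  rw [intervalIntegral.integral_sub (Continuous.intervalIntegrable (by fun_prop) _ _)
    (Continuous.intervalIntegrable (by fun_prop) _ _), mul_sub]

/-- Two integrations by parts, with vanishing Neumann data at the end points. -/
lemma cosCoeff_deriv_deriv {φ φ' φ'' : ℝ → ℝ} (h1 : ∀ x, HasDerivAt φ (φ' x) x)
    (h2 : ∀ x, HasDerivAt φ' (φ'' x) x) (hc : Continuous φ'') (h0 : φ' 0 = 0)
    (hpi : φ' Real.pi = 0) (j : ℕ) :
    cosCoeff φ'' j = -((j + 1 : ℝ) ^ 2 * cosCoeff φ j) := by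
  have hφ : Continuous φ := continuous_iff_continuousAt.2 fun x => (h1 x).continuousAt
  have hd : ∀ x ∈ uIcc (0 : ℝ) Real.pi, HasDerivAt
      (fun x => φ x * ((j + 1 : ℝ) * Real.sin ((j + 1 : ℝ) * x)) +
        φ' x * Real.cos ((j + 1 : ℝ) * x))
      ((j + 1 : ℝ) ^ 2 * (φ x * Real.cos ((j + 1 : ℝ) * x)) +
        φ'' x * Real.cos ((j + 1 : ℝ) * x)) x := by
    intro x _
    have hl : HasDerivAt (fun x : ℝ => (j + 1 : ℝ) * x) (j + 1 : ℝ) x := by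
      simpa using (hasDerivAt_id x).const_mul (j + 1 : ℝ)
    refine (((h1 x).fun_mul (hl.sin.const_mul (j + 1 : ℝ))).fun_add
      ((h2 x).fun_mul hl.cos)).congr_deriv ?_
    ring
  have hs : Real.sin ((j + 1 : ℝ) * Real.pi) = 0 := by
    exact_mod_cast Real.sin_nat_mul_pi (j + 1)
  have key := intervalIntegral.integral_eq_sub_of_hasDerivAt hd
    (Continuous.intervalIntegrable (by fun_prop) _ _)
  rw [intervalIntegral.integral_add (Continuous.intervalIntegrable (by fun_prop) _ _)
    (Continuous.intervalIntegrable (by fun_prop) _ _), intervalIntegral.integral_const_mul,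
    hs, h0, hpi] at key
  simp only [mul_zero, Real.sin_zero, zero_mul, add_zero, sub_zero] at key
  rw [cosCoeff, cosCoeff, eq_neg_of_add_eq_zero_right key]
  ring

lemma sum_inv_sq_le_two (n : ℕ) : ∑ j ∈ Finset.range n, (1 / (j + 1 : ℝ)) ^ 2 ≤ 2 := by
  have h : ∀ n : ℕ, ∑ j ∈ Finset.range n, (1 / (j + 1 : ℝ)) ^ 2 ≤ 2 - 1 / (n : ℝ) := by
    intro n
    induction n with
    | zero => norm_num
    | succ n ih =>
      rw [Finset.sum_range_succ]
      rcases Nat.eq_zero_or_pos n with rfl | hn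
      · norm_num
      · have hn' : (0 : ℝ) < n := by exact_mod_cast hn
        have : (1 / (n + 1 : ℝ)) ^ 2 ≤ 1 / n - 1 / ((n + 1 : ℕ) : ℝ) := by
          have e : 1 / (n : ℝ) - 1 / ((n + 1 : ℕ) : ℝ) = 1 / (n * (n + 1)) := by
            push_cast
            field_simp
            ring
          rw [e, one_div_pow]
          exact one_div_le_one_div_of_le (by positivity) (by nlinarith)
        linarith
  exact (h n).trans (by linarith [show (0 : ℝ) ≤ 1 / (n : ℝ) by positivity])

lemma sum_mul_abs_le {a : ℕ → ℝ} {n : ℕ} {Q : ℝ}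
    (h : ∑ j ∈ Finset.range n, (j + 1 : ℝ) ^ 4 * a j ^ 2 ≤ Q) :
    ∑ j ∈ Finset.range n, (j + 1 : ℝ) * |a j| ≤ √(2 * Q) := by
  apply Real.le_sqrt_of_sq_le
  have hcs := Finset.sum_mul_sq_le_sq_mul_sq (Finset.range n) (fun j => 1 / (j + 1 : ℝ))
    (fun j => (j + 1 : ℝ) ^ 2 * |a j|)
  have h1 : ∀ j : ℕ, 1 / (j + 1 : ℝ) * ((j + 1 : ℝ) ^ 2 * |a j|) = (j + 1 : ℝ) * |a j| := by
    intro j; field_simp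
  have h2 : ∀ j : ℕ, ((j + 1 : ℝ) ^ 2 * |a j|) ^ 2 = (j + 1 : ℝ) ^ 4 * a j ^ 2 := by
    intro j; rw [mul_pow, sq_abs]; ring
  simp_rw [h1, h2] at hcs
  refine hcs.trans (mul_le_mul (sum_inv_sq_le_two n) h (Finset.sum_nonneg fun j _ => ?_)
    zero_le_two)
  positivity

lemma continuous_sinPoly (a : ℕ → ℝ) (n : ℕ) : Continuous (sinPoly a n) := by
  unfold sinPoly
  fun_prop

lemma cosCoeff_comp_add_sinPoly {η η₁ η₂ : ℝ → ℝ} {ε : ℝ} (h1 : ∀ x, HasDerivAt η (η₁ x) x)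
    (h2 : ∀ x, HasDerivAt η₁ (η₂ x) x) (hc : Continuous η₂) (h0 : η₁ 0 = 0)
    (hpi : η₁ Real.pi = 0) (hb1 : ∀ x, |η₁ x| ≤ ε) (hb2 : ∀ x, |η₂ x| ≤ ε)
    {a : ℕ → ℝ} {n : ℕ} (ha : ∑ j ∈ Finset.range n, (j + 1 : ℝ) ^ 4 * a j ^ 2 ≤ 1) (m : ℕ) :
    ∑ j ∈ Finset.range m, (j + 1 : ℝ) ^ 4 * cosCoeff (fun x => η (x + sinPoly a n x)) j ^ 2 ≤
      146 * ε ^ 2 := by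
  have hη₁ : Continuous η₁ := continuous_iff_continuousAt.2 fun x => (h2 x).continuousAt
  have hs := continuous_sinPoly a n
  set s₁ : ℝ → ℝ := fun x =>
    ∑ j ∈ Finset.range n, a j * ((j + 1 : ℝ) * Real.cos ((j + 1 : ℝ) * x)) with hs₁
  set s₂ : ℝ → ℝ := sinPoly (fun j => -((j + 1 : ℝ) ^ 2 * a j)) n with hs₂
  have hs₂c : Continuous s₂ := continuous_sinPoly _ _
  have hs₁c : Continuous s₁ := by rw [hs₁]; fun_prop
  have hl : ∀ (j : ℕ) (x : ℝ), HasDerivAt (fun x : ℝ => (j + 1 : ℝ) * x) (j + 1 : ℝ) x := by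
    intro j x
    simpa using (hasDerivAt_id x).const_mul (j + 1 : ℝ)
  have hd1 : ∀ x, HasDerivAt (sinPoly a n) (s₁ x) x := by
    intro x
    refine (HasDerivAt.fun_sum fun j _ => ((hl j x).sin.const_mul (a j))).congr_deriv ?_
    exact Finset.sum_congr rfl fun j _ => by ring
  have hd2 : ∀ x, HasDerivAt s₁ (s₂ x) x := by
    intro x
    refine (HasDerivAt.fun_sum fun j _ =>
      (((hl j x).cos.const_mul (j + 1 : ℝ)).const_mul (a j))).congr_deriv ?_
    exact Finset.sum_congr rfl fun j _ => by ring
  have hX : ∀ x, HasDerivAt (fun x => x + sinPoly a n x) (1 + s₁ x) x := fun x =>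
    (hasDerivAt_id x).fun_add (hd1 x)
  have hφ1 : ∀ x, HasDerivAt (fun x => η (x + sinPoly a n x))
      (η₁ (x + sinPoly a n x) * (1 + s₁ x)) x := fun x => (h1 _).comp x (hX x)
  have hφ2 : ∀ x, HasDerivAt (fun x => η₁ (x + sinPoly a n x) * (1 + s₁ x))
      (η₂ (x + sinPoly a n x) * (1 + s₁ x) ^ 2 + η₁ (x + sinPoly a n x) * s₂ x) x := by
    intro x
    refine (((h2 _).comp x (hX x)).fun_mul ((hd2 x).const_add 1)).congr_deriv ?_
    simp only [Function.comp]
    ring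
  have hz : ∀ k : ℕ, sinPoly a n (k * Real.pi) = 0 := by
    intro k
    refine Finset.sum_eq_zero fun j _ => ?_
    have : ((j : ℝ) + 1) * (k * Real.pi) = ((j + 1) * k : ℕ) * Real.pi := by push_cast; ring
    rw [this, Real.sin_nat_mul_pi, mul_zero]
  have hz0 : sinPoly a n 0 = 0 := by simpa using hz 0
  have hz1 : sinPoly a n Real.pi = 0 := by simpa using hz 1
  have hc2 : Continuous fun x =>
      η₂ (x + sinPoly a n x) * (1 + s₁ x) ^ 2 + η₁ (x + sinPoly a n x) * s₂ x := by fun_prop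
  have hb := sum_cosCoeff_sq_le hc2 m
  simp_rw [cosCoeff_deriv_deriv hφ1 hφ2 hc2 (by simp [hz0, h0]) (by simp [hz1, hpi])] at hb
  have hs1b : ∀ x, (s₁ x) ^ 2 ≤ 2 := by
    intro x
    have : |s₁ x| ≤ √(2 * 1) := by
      refine le_trans ?_ (sum_mul_abs_le ha)
      refine (Finset.abs_sum_le_sum_abs _ _).trans (Finset.sum_le_sum fun j _ => ?_)
      rw [abs_mul, abs_mul, abs_of_nonneg (by positivity : (0 : ℝ) ≤ j + 1)]
      have := Real.abs_cos_le_one ((j + 1 : ℝ) * x)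
      calc |a j| * ((j + 1 : ℝ) * |Real.cos ((j + 1 : ℝ) * x)|)
          ≤ |a j| * ((j + 1 : ℝ) * 1) := by gcongr
        _ = _ := by ring
    have h3 := pow_le_pow_left₀ (abs_nonneg _) this 2
    rw [sq_abs, Real.sq_sqrt (by norm_num)] at h3
    linarith
  have hpt : ∀ x, (η₂ (x + sinPoly a n x) * (1 + s₁ x) ^ 2 +
      η₁ (x + sinPoly a n x) * s₂ x) ^ 2 ≤ ε ^ 2 * 72 + ε ^ 2 * 2 * s₂ x ^ 2 := by
    intro x
    have hA : (1 + s₁ x) ^ 2 ≤ 6 := by nlinarith [hs1b x, sq_nonneg (s₁ x - 3 / 2)]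
    have hE2 : η₂ (x + sinPoly a n x) ^ 2 ≤ ε ^ 2 := sq_le_sq' (abs_le.1 (hb2 _)).1 (abs_le.1 (hb2 _)).2
    have hE1 : η₁ (x + sinPoly a n x) ^ 2 ≤ ε ^ 2 := sq_le_sq' (abs_le.1 (hb1 _)).1 (abs_le.1 (hb1 _)).2
    calc _ ≤ 2 * (η₂ (x + sinPoly a n x) ^ 2 * ((1 + s₁ x) ^ 2) ^ 2 +
          η₁ (x + sinPoly a n x) ^ 2 * s₂ x ^ 2) := by
          nlinarith [sq_nonneg (η₂ (x + sinPoly a n x) * (1 + s₁ x) ^ 2 -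
            η₁ (x + sinPoly a n x) * s₂ x)]
      _ ≤ 2 * (ε ^ 2 * 6 ^ 2 + ε ^ 2 * s₂ x ^ 2) := by gcongr
      _ = _ := by ring
  have hint := intervalIntegral.integral_mono_on (μ := MeasureTheory.volume) Real.pi_pos.le
    ((hc2.pow 2).intervalIntegrable _ _)
    (Continuous.intervalIntegrable (by fun_prop : Continuous fun x => ε ^ 2 * 72 + ε ^ 2 * 2 * s₂ x ^ 2) _ _)
    fun x _ => hpt x
  rw [intervalIntegral.integral_add (Continuous.intervalIntegrable (by fun_prop) _ _)
    (Continuous.intervalIntegrable (by fun_prop) _ _), intervalIntegral.integral_const_mul (ε ^ 2 * 2), hs₂,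
    integral_sinPoly_sq, intervalIntegral.integral_const] at hint
  have e1 : ∑ j ∈ Finset.range n, (-((j + 1 : ℝ) ^ 2 * a j)) ^ 2 ≤ 1 := by
    refine le_trans (le_of_eq (Finset.sum_congr rfl fun j _ => ?_)) ha
    ring
  have e2 : ∑ j ∈ Finset.range m,
      (-((j + 1 : ℝ) ^ 2 * cosCoeff (fun x => η (x + sinPoly a n x)) j)) ^ 2 =
      ∑ j ∈ Finset.range m, (j + 1 : ℝ) ^ 4 * cosCoeff (fun x => η (x + sinPoly a n x)) j ^ 2 :=
    Finset.sum_congr rfl fun j _ => by ring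
  rw [e2] at hb
  have e3 : ε ^ 2 * 2 * (Real.pi / 2 * ∑ j ∈ Finset.range n, (-((j + 1 : ℝ) ^ 2 * a j)) ^ 2) ≤
      ε ^ 2 * 2 * (Real.pi / 2 * 1) := by gcongr
  have hfin := hb.trans hint
  rw [smul_eq_mul, sub_zero] at hfin
  have : Real.pi / 2 * ∑ j ∈ Finset.range m,
      (j + 1 : ℝ) ^ 4 * cosCoeff (fun x => η (x + sinPoly a n x)) j ^ 2 ≤
      Real.pi / 2 * (146 * ε ^ 2) := by linarith
  exact le_of_mul_le_mul_left this (by positivity)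

lemma sum_cosCoeff_sub_sq_le {η : ℝ → ℝ} {ε : ℝ} (hη : ∀ x y, |η x - η y| ≤ ε * |x - y|)
    (hc : Continuous η) (a b : ℕ → ℝ) (n m : ℕ) :
    ∑ j ∈ Finset.range m, (cosCoeff (fun x => η (x + sinPoly a n x)) j -
        cosCoeff (fun x => η (x + sinPoly b n x)) j) ^ 2 ≤
      ε ^ 2 * ∑ j ∈ Finset.range n, (a j - b j) ^ 2 := by
  have ha := continuous_sinPoly a n
  have hb := continuous_sinPoly b n
  have hab := continuous_sinPoly (fun j => a j - b j) n
  have h := sum_cosCoeff_sq_le (φ := fun x => η (x + sinPoly a n x) - η (x + sinPoly b n x))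
    (by fun_prop) m
  simp_rw [cosCoeff_sub (φ := fun x => η (x + sinPoly a n x))
    (ψ := fun x => η (x + sinPoly b n x)) (by fun_prop) (by fun_prop)] at h
  have hpt : ∀ x, (η (x + sinPoly a n x) - η (x + sinPoly b n x)) ^ 2 ≤
      ε ^ 2 * sinPoly (fun j => a j - b j) n x ^ 2 := by
    intro x
    have e : sinPoly (fun j => a j - b j) n x = (x + sinPoly a n x) - (x + sinPoly b n x) := by
      simp only [sinPoly, sub_mul, Finset.sum_sub_distrib]
      ring
    rw [← sq_abs (η _ - _), e, ← sq_abs ((x + sinPoly a n x) - _), ← mul_pow]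
    exact pow_le_pow_left₀ (abs_nonneg _) (hη _ _) 2
  have hint := intervalIntegral.integral_mono_on (μ := MeasureTheory.volume) Real.pi_pos.le
    (Continuous.intervalIntegrable (by fun_prop) _ _)
    (Continuous.intervalIntegrable (by fun_prop) _ _) fun x _ => hpt x
  rw [intervalIntegral.integral_const_mul, integral_sinPoly_sq] at hint
  refine le_of_mul_le_mul_left ((h.trans hint).trans (le_of_eq ?_))
    (by positivity : 0 < Real.pi / 2)
  ring

/-- Truncated Picard iterates for the equation `∑ aⱼ cos ((j+1) x) = η (x + ∑ aⱼ sin ((j+1) x))`,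
modulo constants. -/
def coeffIter (η : ℝ → ℝ) : ℕ → ℕ → ℝ
  | 0 => fun _ => 0
  | n + 1 => fun j =>
    if j < n + 1 then cosCoeff (fun x => η (x + sinPoly (coeffIter η n) n x)) j else 0

lemma coeffIter_succ (η : ℝ → ℝ) (n j : ℕ) : coeffIter η (n + 1) j =
    if j < n + 1 then cosCoeff (fun x => η (x + sinPoly (coeffIter η n) n x)) j else 0 := rfl

lemma coeffIter_of_le (η : ℝ → ℝ) {n j : ℕ} (h : n ≤ j) : coeffIter η n j = 0 := by
  cases n with
  | zero => rfl
  | succ n => rw [coeffIter_succ, if_neg (by omega)]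

lemma sinPoly_coeffIter_succ (η : ℝ → ℝ) (n : ℕ) (x : ℝ) :
    sinPoly (coeffIter η n) (n + 1) x = sinPoly (coeffIter η n) n x := by
  rw [sinPoly, Finset.sum_range_succ, coeffIter_of_le η le_rfl, zero_mul, add_zero, sinPoly]

lemma sum_coeffIter_sq_le {η η₁ η₂ : ℝ → ℝ} {ε : ℝ} (h1 : ∀ x, HasDerivAt η (η₁ x) x)
    (h2 : ∀ x, HasDerivAt η₁ (η₂ x) x) (hc : Continuous η₂) (h0 : η₁ 0 = 0)
    (hpi : η₁ Real.pi = 0) (hε : 0 ≤ ε) (hε' : ε ≤ 1 / 40) (hb1 : ∀ x, |η₁ x| ≤ ε)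
    (hb2 : ∀ x, |η₂ x| ≤ ε) (n m : ℕ) :
    ∑ j ∈ Finset.range m, (j + 1 : ℝ) ^ 4 * coeffIter η n j ^ 2 ≤ 146 * ε ^ 2 := by
  induction n generalizing m with
  | zero =>
    simp only [coeffIter]
    simp
    positivity
  | succ n ih =>
    have ha := (ih n).trans (show 146 * ε ^ 2 ≤ 1 by nlinarith)
    refine le_trans (Finset.sum_le_sum fun j _ => ?_)
      (cosCoeff_comp_add_sinPoly h1 h2 hc h0 hpi hb1 hb2 ha m)
    rw [coeffIter_succ]
    split_ifs
    · exact le_rfl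
    · rw [zero_pow two_ne_zero, mul_zero]
      positivity

lemma abs_le_of_sum_le {a : ℕ → ℝ}
    (h : ∀ m, ∑ j ∈ Finset.range m, (j + 1 : ℝ) ^ 4 * a j ^ 2 ≤ 1) (j : ℕ) :
    |a j| ≤ 1 / (j + 1 : ℝ) ^ 2 := by
  have h1 : (j + 1 : ℝ) ^ 4 * a j ^ 2 ≤ 1 :=
    (Finset.single_le_sum (f := fun j : ℕ => (j + 1 : ℝ) ^ 4 * a j ^ 2)
      (fun i _ => by positivity) (Finset.self_mem_range_succ j)).trans (h (j + 1))
  rw [le_div_iff₀ (by positivity)]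
  refine abs_le_of_sq_le_sq' ?_ zero_le_one |>.2
  rw [mul_pow, sq_abs]
  linarith

lemma abs_coeffIter_succ_sub_le {η η₁ η₂ : ℝ → ℝ} {ε : ℝ} (h1 : ∀ x, HasDerivAt η (η₁ x) x)
    (h2 : ∀ x, HasDerivAt η₁ (η₂ x) x) (hc : Continuous η₂) (h0 : η₁ 0 = 0)
    (hpi : η₁ Real.pi = 0) (hε : 0 ≤ ε) (hε' : ε ≤ 1 / 40) (hb1 : ∀ x, |η₁ x| ≤ ε)
    (hb2 : ∀ x, |η₂ x| ≤ ε) (n j : ℕ) :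
    |coeffIter η (n + 1) j - coeffIter η n j| ≤ 2 / (n + 1 : ℝ) ^ 2 := by
  have hsum := fun n m => (sum_coeffIter_sq_le h1 h2 hc h0 hpi hε hε' hb1 hb2 n m).trans
    (show 146 * ε ^ 2 ≤ 1 by nlinarith)
  have hηc : Continuous η := continuous_iff_continuousAt.2 fun x => (h1 x).continuousAt
  have hlip : ∀ x y, |η x - η y| ≤ ε * |x - y| := fun x y =>
    convex_univ.norm_image_sub_le_of_norm_hasDerivWithin_le
      (fun x _ => (h1 x).hasDerivWithinAt) (fun x _ => hb1 x) (mem_univ y) (mem_univ x)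
  have hD : ∀ n : ℕ, ∑ j ∈ Finset.range (n + 1), (coeffIter η (n + 1) j - coeffIter η n j) ^ 2 ≤
      2 / (n + 1 : ℝ) ^ 4 := by
    intro n
    induction n with
    | zero =>
      have := hsum 1 1
      simp only [zero_add, Finset.sum_range_one, coeffIter_of_le η (le_refl 0)]
      norm_num at this ⊢
      linarith [(sq_le_one_iff_abs_le_one _).2 this]
    | succ n ih =>
      rw [Finset.sum_range_succ, coeffIter_of_le η (le_refl (n + 1)), sub_zero]
      have hlast : coeffIter η (n + 1 + 1) (n + 1) ^ 2 ≤ 1 / (n + 2 : ℝ) ^ 4 := by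
        have := abs_le_of_sum_le (hsum (n + 1 + 1)) (n + 1)
        rw [← sq_abs]
        refine (pow_le_pow_left₀ (abs_nonneg _) this 2).trans (le_of_eq ?_)
        push_cast
        rw [div_pow, one_pow, ← pow_mul]
        ring
      have hfirst : ∑ j ∈ Finset.range (n + 1),
          (coeffIter η (n + 1 + 1) j - coeffIter η (n + 1) j) ^ 2 ≤
          ε ^ 2 * (2 / (n + 1 : ℝ) ^ 4) := by
        refine le_trans (le_of_eq (Finset.sum_congr rfl fun j hj => ?_))
          ((sum_cosCoeff_sub_sq_le hlip hηc (coeffIter η (n + 1)) (coeffIter η n) (n + 1)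
            (n + 1)).trans (mul_le_mul_of_nonneg_left ih (sq_nonneg ε)))
        have hj' := Finset.mem_range.1 hj
        simp_rw [coeffIter_succ η (n + 1) j, sinPoly_coeffIter_succ]
        rw [if_pos (by omega), coeffIter_succ η n j, if_pos hj']
      have hε2 : ε ^ 2 ≤ 1 / 32 := by nlinarith
      have hratio : 1 / (n + 1 : ℝ) ^ 4 ≤ 16 / (n + 2 : ℝ) ^ 4 := by
        rw [div_le_div_iff₀ (by positivity) (by positivity)]
        have : (n + 2 : ℝ) ≤ 2 * (n + 1) := by linarith [(Nat.cast_nonneg n : (0 : ℝ) ≤ n)]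
        calc 1 * (n + 2 : ℝ) ^ 4 = (n + 2 : ℝ) ^ 4 := one_mul _
          _ ≤ (2 * (n + 1 : ℝ)) ^ 4 := by gcongr
          _ = _ := by ring
      have hp : (0 : ℝ) ≤ 1 / (n + 1 : ℝ) ^ 4 := by positivity
      calc _ ≤ ε ^ 2 * (2 / (n + 1 : ℝ) ^ 4) + 1 / (n + 2 : ℝ) ^ 4 := add_le_add hfirst hlast
        _ = ε ^ 2 * 2 * (1 / (n + 1 : ℝ) ^ 4) + 1 / (n + 2 : ℝ) ^ 4 := by ring
        _ ≤ 1 / 32 * 2 * (16 / (n + 2 : ℝ) ^ 4) + 1 / (n + 2 : ℝ) ^ 4 := by gcongr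
        _ = 2 / ((n + 1 : ℕ) + 1 : ℝ) ^ 4 := by push_cast; ring
  rcases lt_or_ge j (n + 1) with hj | hj
  · have h3 := (Finset.single_le_sum
      (f := fun j => (coeffIter η (n + 1) j - coeffIter η n j) ^ 2)
      (fun i _ => sq_nonneg _) (Finset.mem_range.2 hj)).trans (hD n)
    refine abs_le_of_sq_le_sq ?_ (by positivity)
    refine h3.trans ?_
    rw [div_pow, ← pow_mul]
    gcongr
    norm_num
  · rw [coeffIter_of_le η hj, coeffIter_of_le η ((Nat.le_succ n).trans hj), sub_zero, abs_zero]
    positivity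

/-- Fourier inversion for even periodic functions with summable cosine coefficients. -/
lemma hasSum_cosCoeff {φ : ℝ → ℝ} (hφ : Continuous φ) (heven : ∀ x, φ (-x) = φ x)
    (hper : Function.Periodic φ (2 * Real.pi)) (hs : Summable fun j => |cosCoeff φ j|) (x : ℝ) :
    HasSum (fun j : ℕ => cosCoeff φ j * Real.cos ((j + 1 : ℝ) * x))
      (φ x - 1 / Real.pi * ∫ t in (0 : ℝ)..Real.pi, φ t) := by
  have : Fact (0 < 2 * Real.pi) := ⟨Real.two_pi_pos⟩
  have hper' : Function.Periodic (fun x => (φ x : ℂ)) (2 * Real.pi) := fun x => by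
    simp only [hper x]
  let F : C(AddCircle (2 * Real.pi), ℂ) :=
    ⟨hper'.lift, continuous_coinduced_dom.2 (by
      exact Complex.continuous_ofReal.comp hφ)⟩
  have hF : ∀ x : ℝ, F (x : AddCircle (2 * Real.pi)) = (φ x : ℂ) := fun x => hper'.lift_coe x
  have hfou : ∀ (n : ℤ) (x : ℝ), fourier n (x : AddCircle (2 * Real.pi)) =
      (Real.cos (n * x) : ℂ) + (Real.sin (n * x) : ℂ) * Complex.I := by
    intro n x
    rw [fourier_coe_apply, Complex.ofReal_cos, Complex.ofReal_sin, ← Complex.exp_mul_I]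
    congr 1
    have : (Real.pi : ℂ) ≠ 0 := by exact_mod_cast Real.pi_ne_zero
    push_cast
    field_simp
  have hcoef : ∀ n : ℤ, fourierCoeff F n =
      ((1 / Real.pi * ∫ t in (0 : ℝ)..Real.pi, φ t * Real.cos (n * t) : ℝ) : ℂ) := by
    intro n
    rw [fourierCoeff_eq_intervalIntegral F n (-Real.pi)]
    have e : -Real.pi + 2 * Real.pi = Real.pi := by ring
    simp_rw [hF, hfou]
    have hsplit := intervalIntegral.integral_add_adjacent_intervals
      (f := fun x : ℝ => ((Real.cos ((-n : ℤ) * x) : ℂ) + (Real.sin ((-n : ℤ) * x) : ℂ) *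
        Complex.I) • (φ x : ℂ)) (μ := MeasureTheory.volume) (a := -Real.pi) (b := 0)
      (c := Real.pi) (Continuous.intervalIntegrable (by fun_prop) _ _)
      (Continuous.intervalIntegrable (by fun_prop) _ _)
    have hneg := intervalIntegral.integral_comp_neg (a := 0) (b := Real.pi)
      (f := fun x : ℝ => ((Real.cos ((-n : ℤ) * x) : ℂ) + (Real.sin ((-n : ℤ) * x) : ℂ) *
        Complex.I) • (φ x : ℂ))
    rw [neg_zero] at hneg
    rw [e, ← hsplit, ← hneg, ← intervalIntegral.integral_add
      (Continuous.intervalIntegrable (by fun_prop) _ _)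
      (Continuous.intervalIntegrable (by fun_prop) _ _)]
    have hpt : ∀ x : ℝ, ((Real.cos ((-n : ℤ) * -x) : ℂ) + (Real.sin ((-n : ℤ) * -x) : ℂ) *
        Complex.I) • (φ (-x) : ℂ) + ((Real.cos ((-n : ℤ) * x) : ℂ) +
        (Real.sin ((-n : ℤ) * x) : ℂ) * Complex.I) • (φ x : ℂ) =
        ((2 * (φ x * Real.cos (n * x)) : ℝ) : ℂ) := by
      intro x
      rw [heven]
      push_cast
      simp only [neg_mul, mul_neg, neg_neg, Complex.sin_neg, Complex.cos_neg, smul_eq_mul]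
      ring
    simp_rw [hpt]
    rw [intervalIntegral.integral_ofReal, intervalIntegral.integral_const_mul, Complex.real_smul,
      ← Complex.ofReal_mul]
    congr 1
    field_simp
  have hcs : ∀ j : ℕ, fourierCoeff F ((j : ℤ) + 1) = ((cosCoeff φ j / 2 : ℝ) : ℂ) ∧
      fourierCoeff F (-((j : ℤ) + 1)) = ((cosCoeff φ j / 2 : ℝ) : ℂ) := by
    intro j
    have e1 : ∀ t : ℝ, Real.cos (((j : ℤ) + 1 : ℤ) * t) = Real.cos ((j + 1 : ℝ) * t) := by
      intro t
      push_cast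
      rfl
    have e2 : ∀ t : ℝ, Real.cos ((-((j : ℤ) + 1) : ℤ) * t) = Real.cos ((j + 1 : ℝ) * t) := by
      intro t
      rw [← Real.cos_neg]
      push_cast
      congr 1
      ring
    rw [hcoef, hcoef, cosCoeff]
    simp_rw [e1, e2]
    constructor <;> · congr 1; ring
  have h1 : Summable fun j : ℕ => ((cosCoeff φ j / 2 : ℝ) : ℂ) :=
    Complex.summable_ofReal.2 ((summable_abs_iff.1 hs).div_const 2)
  have hsum : Summable (fourierCoeff F) := Summable.of_add_one_of_neg_add_one
    (h1.congr fun j => (hcs j).1.symm) (h1.congr fun j => (hcs j).2.symm)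
  have h2 := (has_pointwise_sum_fourier_series_of_summable hsum
    (x : AddCircle (2 * Real.pi))).nat_add_neg
  rw [← hasSum_nat_add_iff' 1] at h2
  rw [← Complex.hasSum_ofReal]
  convert h2 using 1
  · rfl
  · ext j
    simp only [Nat.cast_add, Nat.cast_one, (hcs j).1, (hcs j).2, hfou, smul_eq_mul]
    have e : (((-((j : ℤ) + 1) : ℤ) : ℝ)) * x = -((j + 1 : ℝ) * x) := by
      push_cast
      ring
    rw [e, Real.cos_neg, Real.sin_neg]
    push_cast
    ring
  · rw [hF]
    simp only [Finset.sum_range_one, Nat.cast_zero, neg_zero, hcoef, hfou]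
    simp

lemma summable_inv_sq : Summable fun j : ℕ => 1 / (j + 1 : ℝ) ^ 2 := by
  have := (summable_nat_add_iff 1).2 (Real.summable_one_div_nat_pow.2 one_lt_two)
  simpa using this

open Filter Topology in
lemma exists_conjugate_coeffs {η η₁ η₂ : ℝ → ℝ} {ε : ℝ} (h1 : ∀ x, HasDerivAt η (η₁ x) x)
    (h2 : ∀ x, HasDerivAt η₁ (η₂ x) x) (hc : Continuous η₂) (h0 : η₁ 0 = 0)
    (hpi : η₁ Real.pi = 0) (hε : 0 ≤ ε) (hε' : ε ≤ 1 / 40) (hb0 : ∀ x, |η x| ≤ ε)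
    (hb1 : ∀ x, |η₁ x| ≤ ε) (hb2 : ∀ x, |η₂ x| ≤ ε) (heven : ∀ x, η (-x) = η x)
    (hper : Function.Periodic η (2 * Real.pi)) :
    ∃ (α : ℝ) (a : ℕ → ℝ), (Summable fun j : ℕ => (j + 1 : ℝ) * |a j|) ∧
      (∑' j : ℕ, (j + 1 : ℝ) * |a j| ≤ 18 * ε) ∧
      ∀ x, HasSum (fun j : ℕ => a j * Real.cos ((j + 1 : ℝ) * x))
        (η (x + ∑' j : ℕ, a j * Real.sin ((j + 1 : ℝ) * x)) - α) := by
  have hηc : Continuous η := continuous_iff_continuousAt.2 fun x => (h1 x).continuousAt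
  have hsum := fun n m => sum_coeffIter_sq_le h1 h2 hc h0 hpi hε hε' hb1 hb2 n m
  have hε1 : 146 * ε ^ 2 ≤ 1 := by nlinarith
  have hcau : ∀ j, CauchySeq fun n => coeffIter η n j := by
    intro j
    refine cauchySeq_of_dist_le_of_summable (fun n : ℕ => 2 / (n + 1 : ℝ) ^ 2) (fun n => ?_) ?_
    · rw [dist_comm, Real.dist_eq]
      exact abs_coeffIter_succ_sub_le h1 h2 hc h0 hpi hε hε' hb1 hb2 n j
    · simpa [div_eq_mul_inv] using summable_inv_sq.mul_left 2
  choose a ha using fun j => cauchySeq_tendsto_of_complete (hcau j)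
  have hasum : ∀ m, ∑ j ∈ Finset.range m, (j + 1 : ℝ) ^ 4 * a j ^ 2 ≤ 146 * ε ^ 2 := fun m =>
    le_of_tendsto' (tendsto_finsetSum _ fun j _ => ((ha j).pow 2).const_mul _)
      fun n => hsum n m
  have habs := abs_le_of_sum_le fun m => (hasum m).trans hε1
  have hpart : ∀ m, ∑ j ∈ Finset.range m, (j + 1 : ℝ) * |a j| ≤ 18 * ε := by
    intro m
    refine (sum_mul_abs_le (hasum m)).trans ?_
    rw [Real.sqrt_le_left (by positivity)]
    nlinarith
  have hS : Summable fun j : ℕ => (j + 1 : ℝ) * |a j| :=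
    summable_of_sum_range_le (fun j => by positivity) hpart
  have hSa : Summable fun j : ℕ => |a j| := Summable.of_nonneg_of_le (fun j => abs_nonneg _)
    (fun j => le_mul_of_one_le_left (abs_nonneg _) (by simp)) hS
  have hsa : ∀ (b : ℕ → ℝ) (j : ℕ) (x : ℝ), ‖b j * Real.sin ((j + 1 : ℝ) * x)‖ ≤ |b j| := by
    intro b j x
    rw [norm_mul]
    exact mul_le_of_le_one_right (abs_nonneg _) (Real.abs_sin_le_one _)
  set s : ℝ → ℝ := fun x => ∑' j : ℕ, a j * Real.sin ((j + 1 : ℝ) * x) with hs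
  have hsc : Continuous s := continuous_tsum (fun j => by fun_prop) hSa fun j x => hsa a j x
  have hlim : ∀ x, Tendsto (fun n => sinPoly (coeffIter η n) n x) atTop (𝓝 (s x)) := by
    intro x
    have e : ∀ n, sinPoly (coeffIter η n) n x =
        ∑' j : ℕ, coeffIter η n j * Real.sin ((j + 1 : ℝ) * x) := by
      intro n
      rw [sinPoly, tsum_eq_sum]
      intro j hj
      rw [coeffIter_of_le η (by simpa using hj), zero_mul]
    simp_rw [e]
    refine tendsto_tsum_of_dominated_convergence summable_inv_sq
      (fun j => (ha j).mul_const _) (Eventually.of_forall fun n j => ?_)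
    exact (hsa _ j x).trans (abs_le_of_sum_le (fun m => (hsum n m).trans hε1) j)
  have hcoef : ∀ j, cosCoeff (fun x => η (x + s x)) j = a j := by
    intro j
    refine tendsto_nhds_unique ?_ ((tendsto_add_atTop_iff_nat 1).2 (ha j))
    have h3 : Tendsto (fun n => cosCoeff (fun x => η (x + sinPoly (coeffIter η n) n x)) j)
        atTop (𝓝 (cosCoeff (fun x => η (x + s x)) j)) := by
      refine Tendsto.const_mul _ ?_
      refine intervalIntegral.tendsto_integral_filter_of_dominated_convergence (fun _ => ε)
        (Eventually.of_forall fun n => ?_) (Eventually.of_forall fun n => ?_)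
        intervalIntegrable_const ?_
      · have := continuous_sinPoly (coeffIter η n) n
        exact (by fun_prop : Continuous fun x => η (x + sinPoly (coeffIter η n) n x) *
          Real.cos ((j + 1 : ℝ) * x)).aestronglyMeasurable
      · refine MeasureTheory.ae_of_all _ fun x _ => ?_
        rw [norm_mul]
        exact (mul_le_of_le_one_right (norm_nonneg _) (Real.abs_cos_le_one _)).trans (hb0 _)
      · refine MeasureTheory.ae_of_all _ fun x _ => ?_
        exact ((hηc.tendsto _).comp ((hlim x).const_add x)).mul_const _
    refine h3.congr' ?_
    filter_upwards [eventually_ge_atTop j] with n hn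
    rw [coeffIter_succ, if_pos (by omega)]
  refine ⟨1 / Real.pi * ∫ t in (0 : ℝ)..Real.pi, η (t + s t), a, hS,
    hS.tsum_le_of_sum_range_le hpart, fun x => ?_⟩
  have hodd : ∀ x, s (-x) = - s x := by
    intro x
    simp only [hs, mul_neg, Real.sin_neg, tsum_neg]
  have hsper : ∀ x, s (x + 2 * Real.pi) = s x := by
    intro x
    refine tsum_congr fun j => ?_
    have : (j + 1 : ℝ) * (x + 2 * Real.pi) = (j + 1 : ℝ) * x + ((j + 1 : ℕ) : ℝ) * (2 * Real.pi) := by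
      push_cast; ring
    rw [this, Real.sin_add_nat_mul_two_pi]
  have := hasSum_cosCoeff (φ := fun x => η (x + s x)) (by fun_prop)
    (fun x => by rw [hodd, ← neg_add, heven])
    (fun x => by
      simp only [hsper]
      rw [add_right_comm, hper]) (by simpa only [hcoef] using hSa) x
  simpa only [hcoef] using this

/-- Reflection of the upper half-plane onto the lower half-plane. -/
def foldDown (z : ℂ) : ℂ := ⟨z.re, -|z.im|⟩

lemma foldDown_im_nonpos (z : ℂ) : (foldDown z).im ≤ 0 := neg_nonpos.2 (abs_nonneg _)

lemma foldDown_of_im_nonpos {z : ℂ} (h : z.im ≤ 0) : foldDown z = z := by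
  apply Complex.ext <;> simp [foldDown, abs_of_nonpos h]

lemma norm_foldDown_sub_le (z w : ℂ) : ‖foldDown z - foldDown w‖ ≤ ‖z - w‖ := by
  rw [Complex.norm_eq_sqrt_sq_add_sq, Complex.norm_eq_sqrt_sq_add_sq]
  apply Real.sqrt_le_sqrt
  simp only [foldDown, Complex.sub_re, Complex.sub_im]
  have : (-|z.im| - -|w.im|) ^ 2 ≤ (z.im - w.im) ^ 2 := by
    rw [sq_le_sq, neg_sub_neg, abs_sub_comm]
    exact abs_abs_sub_abs_le_abs_sub z.im w.im
  linarith

open Filter Topology in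
/-- A holomorphic perturbation of the identity on the lower half-plane which is a contraction up
to the boundary and sends the real axis to a graph is the inverse of a map flattening that
graph. -/
lemma exists_flattening_of_perturbation {η : ℝ → ℝ} (hη : Continuous η) {f : ℂ → ℂ} {c M B : ℝ}
    (hc0 : 0 ≤ c) (hc : c ≤ 1 / 2)
    (hlip : ∀ z w : ℂ, z.im ≤ 0 → w.im ≤ 0 → ‖f z - f w‖ ≤ c * ‖z - w‖)
    (hM : ∀ z : ℂ, z.im ≤ 0 → ‖f z‖ ≤ M) (hB : ∀ x, |η x| ≤ B)
    (hd : DifferentiableOn ℂ f {w : ℂ | w.im < 0})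
    (hsurf : ∀ s : ℝ, (f s).im = η (s + (f s).re))
    (hper : ∀ z : ℂ, z.im ≤ 0 → f (z + (2 * Real.pi : ℝ)) = f z)
    (hsym : ∀ z : ℂ, z.im ≤ 0 → f (-(starRingEnd ℂ) z) = -(starRingEnd ℂ) (f z)) :
    ∃ Z : ℂ → ℂ, Continuous Z ∧
      DifferentiableOn ℂ Z (fluidDomain η) ∧
      Set.BijOn Z (fluidDomain η) {w : ℂ | w.im < 0} ∧
      (∀ x : ℝ, (Z ((x : ℂ) + (η x : ℂ) * Complex.I)).im = 0) ∧
      (∀ z, Z (z + (2 * Real.pi : ℝ)) = Z z + (2 * Real.pi : ℝ)) ∧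
      (∀ z, Z (-(starRingEnd ℂ) z) = -(starRingEnd ℂ) (Z z)) ∧
      (∀ z, ‖fderiv ℝ (fun w : ℂ => (Z w).re - w.re) z‖ +
        ‖fderiv ℝ (fun w : ℂ => (Z w).im - w.im) z‖ ≤ 4 * c) := by
  set g : ℂ → ℂ := fun z => f (foldDown z) with hg
  have hglip : ∀ z w, ‖g z - g w‖ ≤ c * ‖z - w‖ := fun z w =>
    (hlip _ _ (foldDown_im_nonpos z) (foldDown_im_nonpos w)).trans
      (mul_le_mul_of_nonneg_left (norm_foldDown_sub_le z w) hc0)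
  have hgM : ∀ z, ‖g z‖ ≤ M := fun z => hM _ (foldDown_im_nonpos z)
  have hgf : ∀ z : ℂ, z.im ≤ 0 → g z = f z := fun z hz => by rw [hg]; simp [foldDown_of_im_nonpos hz]
  have hW : ApproximatesLinearOn (fun z => z + g z)
      ((ContinuousLinearEquiv.refl ℝ ℂ : ℂ ≃L[ℝ] ℂ) : ℂ →L[ℝ] ℂ) univ c.toNNReal := by
    intro z _ w _
    have : z + g z - (w + g w) - (z - w) = g z - g w := by ring
    simpa [this, Real.coe_toNNReal c hc0] using hglip z w
  obtain ⟨e, he⟩ : ∃ e : ℂ ≃ₜ ℂ, ∀ z, e z = z + g z := by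
    refine ⟨hW.toHomeomorph _ (Or.inr ?_), fun z => rfl⟩
    rw [ContinuousLinearEquiv.refl_symm, ContinuousLinearEquiv.coe_refl,
      ContinuousLinearMap.nnnorm_id, inv_one, Real.toNNReal_lt_one]
    linarith
  have hec : Continuous e := e.continuous
  have hgc : Continuous g := by
    have : g = fun z => e z - z := by ext z; rw [he]; ring
    rw [this]; fun_prop
  set φ : ℂ → ℝ := fun z => (e z).im - η (e z).re with hφ
  have hφc : Continuous φ := by
    rw [hφ]
    exact (Complex.continuous_im.comp hec).sub (hη.comp (Complex.continuous_re.comp hec))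
  have hreal : ∀ s : ℝ, e s = ((s + (f s).re : ℝ) : ℂ) + (η (s + (f s).re) : ℂ) * Complex.I := by
    intro s
    rw [he, hgf s (by simp), ← hsurf]
    apply Complex.ext <;> simp
  have hφ0 : ∀ z : ℂ, z.im = 0 → φ z = 0 := by
    intro z hz
    have hz' : z = (z.re : ℂ) := Complex.ext (by simp) (by simp [hz])
    rw [hz', hφ]
    simp [hreal]
  have hX : Function.Surjective fun s : ℝ => s + (f s).re := by
    have hfre : ∀ s : ℝ, |(f s).re| ≤ M := fun s =>
      (Complex.abs_re_le_norm _).trans (hM _ (by simp))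
    refine Continuous.surjective ?_ ?_ ?_
    · have : (fun s : ℝ => s + (f s).re) = fun s : ℝ => s + (g s).re := by
        ext s; rw [hgf s (by simp)]
      rw [this]
      exact continuous_id.add (Complex.continuous_re.comp (hgc.comp Complex.continuous_ofReal))
    · exact tendsto_atTop_add_right_of_le _ (-M) tendsto_id fun s => (abs_le.1 (hfre s)).1
    · exact tendsto_atBot_add_right_of_ge _ M tendsto_id fun s => (abs_le.1 (hfre s)).2
  have hgraph : ∀ x : ℝ, ∃ s : ℝ, e s = (x : ℂ) + (η x : ℂ) * Complex.I := by
    intro x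
    obtain ⟨s, rfl⟩ := hX x
    exact ⟨s, hreal s⟩
  have hφne : ∀ z : ℂ, φ z = 0 → z.im = 0 := by
    intro z hz
    obtain ⟨s, hs⟩ := hgraph (e z).re
    have : e s = e z := by
      rw [hs]
      apply Complex.ext <;> simp
      linarith [show (e z).im - η (e z).re = 0 from hz]
    rw [← e.injective this, Complex.ofReal_im]
  have him : ∀ z, |(g z).im| ≤ M := fun z => (Complex.abs_im_le_norm _).trans (hgM z)
  have hM0 : 0 ≤ M := (norm_nonneg _).trans (hgM 0)
  have hB0 : 0 ≤ B := (abs_nonneg _).trans (hB 0)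
  have hneg : ∀ z : ℂ, z.im < 0 → φ z < 0 := by
    by_contra! ⟨z, hz, hz'⟩
    have hz0 : φ (-(M + B + 1 : ℝ) * Complex.I) ≤ 0 := by
      have h1 := (abs_le.1 (him (-(M + B + 1 : ℝ) * Complex.I))).2
      have h2 := (abs_le.1 (hB (e (-(M + B + 1 : ℝ) * Complex.I)).re)).1
      have h3 : (e (-(M + B + 1 : ℝ) * Complex.I)).im =
          -(M + B + 1) + (g (-(M + B + 1 : ℝ) * Complex.I)).im := by
        rw [he]; simp
      simp only [hφ]
      linarith
    obtain ⟨w, hw, hw'⟩ := (convex_halfSpace_im_lt 0).isPreconnected.intermediate_value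
      (a := -(M + B + 1 : ℝ) * Complex.I) (b := z)
      (by simp; linarith) hz hφc.continuousOn ⟨hz0, hz'⟩
    exact (ne_of_lt hw) (hφne w hw')
  have hpos : ∀ z : ℂ, 0 < z.im → 0 < φ z := by
    by_contra! ⟨z, hz, hz'⟩
    have hz0 : 0 ≤ φ ((M + B + 1 : ℝ) * Complex.I) := by
      have h1 := (abs_le.1 (him ((M + B + 1 : ℝ) * Complex.I))).1
      have h2 := (abs_le.1 (hB (e ((M + B + 1 : ℝ) * Complex.I)).re)).2
      have h3 : (e ((M + B + 1 : ℝ) * Complex.I)).im =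
          (M + B + 1) + (g ((M + B + 1 : ℝ) * Complex.I)).im := by
        rw [he]; simp
      simp only [hφ]
      linarith
    obtain ⟨w, hw, hw'⟩ := (convex_halfSpace_im_gt 0).isPreconnected.intermediate_value
      (a := z) (b := (M + B + 1 : ℝ) * Complex.I)
      hz (by simp; linarith) hφc.continuousOn ⟨hz', hz0⟩
    exact (ne_of_gt hw) (hφne w hw')
  have hiff : ∀ z, e z ∈ fluidDomain η ↔ z.im < 0 := by
    intro z
    have : e z ∈ fluidDomain η ↔ φ z < 0 :=
      (sub_neg (a := (e z).im) (b := η (e z).re)).symm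
    rw [this]
    refine ⟨fun h => ?_, hneg z⟩
    rcases lt_trichotomy z.im 0 with h' | h' | h'
    · exact h'
    · exact absurd (hφ0 z h') h.ne
    · exact absurd (hpos z h') h.not_gt
  have hsub : ∀ w, e.symm w - w = -g (e.symm w) := by
    intro w
    have := e.apply_symm_apply w
    rw [he] at this
    linear_combination this
  have hsymlip : ∀ w v, ‖e.symm w - w - (e.symm v - v)‖ ≤ 2 * c * ‖w - v‖ := by
    intro w v
    have h1 : ‖g (e.symm w) - g (e.symm v)‖ ≤ c * ‖e.symm w - e.symm v‖ := hglip _ _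
    have h2 : ‖e.symm w - e.symm v‖ ≤ ‖w - v‖ + ‖g (e.symm w) - g (e.symm v)‖ := by
      have : e.symm w - e.symm v = (w - v) - (g (e.symm w) - g (e.symm v)) := by
        linear_combination hsub w - hsub v
      rw [this]
      exact norm_sub_le _ _
    have h3 : ‖e.symm w - w - (e.symm v - v)‖ = ‖g (e.symm w) - g (e.symm v)‖ := by
      rw [hsub, hsub, ← norm_neg]
      congr 1
      ring
    rw [h3]
    have h4 : ‖e.symm w - e.symm v‖ ≤ 2 * ‖w - v‖ := by
      nlinarith [norm_nonneg (e.symm w - e.symm v)]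
    nlinarith
  refine ⟨e.symm, e.symm.continuous, ?_, ⟨?_, e.symm.injective.injOn, ?_⟩, ?_, ?_, ?_, ?_⟩
  · intro z hz
    have hw : (e.symm z).im < 0 := (hiff _).1 (by rwa [e.apply_symm_apply])
    have hopen : {w : ℂ | w.im < 0} ∈ 𝓝 (e.symm z) :=
      (isOpen_lt Complex.continuous_im continuous_const).mem_nhds hw
    have hf := (hd.differentiableAt hopen).hasDerivAt
    have hf' : ‖deriv f (e.symm z)‖ ≤ c := hf.le_of_lip' hc0 (by
      filter_upwards [hopen] with w hw'
      exact hlip _ _ (le_of_lt hw') hw.le)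
    have hne : 1 + deriv f (e.symm z) ≠ 0 := by
      intro h0
      rw [eq_neg_of_add_eq_zero_right h0, norm_neg, norm_one] at hf'
      linarith
    have hed : HasDerivAt e (1 + deriv f (e.symm z)) (e.symm z) := by
      refine ((hasDerivAt_id _).fun_add hf).congr_of_eventuallyEq ?_
      filter_upwards [hopen] with w hw'
      rw [he, hgf w (le_of_lt hw')]
      rfl
    exact (HasDerivAt.of_local_left_inverse e.symm.continuous.continuousAt hed hne
      (Eventually.of_forall e.apply_symm_apply)).differentiableAt.differentiableWithinAt
  · intro z hz
    exact (hiff _).1 (by rwa [e.apply_symm_apply])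
  · intro w hw
    exact ⟨e w, (hiff w).2 hw, e.symm_apply_apply w⟩
  · intro x
    obtain ⟨s, hs⟩ := hgraph x
    rw [← hs, e.symm_apply_apply, Complex.ofReal_im]
  · intro z
    rw [e.symm_apply_eq, he]
    have h1 : g (e.symm z + (2 * Real.pi : ℝ)) = g (e.symm z) := by
      rw [hg]
      have : foldDown (e.symm z + (2 * Real.pi : ℝ)) =
          foldDown (e.symm z) + (2 * Real.pi : ℝ) := by
        apply Complex.ext <;> simp [foldDown]
      simp only [this, hper _ (foldDown_im_nonpos _)]
    rw [h1]
    linear_combination -hsub z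
  · intro z
    rw [e.symm_apply_eq, he]
    have h1 : g (-(starRingEnd ℂ) (e.symm z)) = -(starRingEnd ℂ) (g (e.symm z)) := by
      rw [hg]
      have : foldDown (-(starRingEnd ℂ) (e.symm z)) =
          -(starRingEnd ℂ) (foldDown (e.symm z)) := by
        apply Complex.ext <;> simp [foldDown]
      simp only [this, hsym _ (foldDown_im_nonpos _)]
    have h2 := congrArg (starRingEnd ℂ) (hsub z)
    simp only [map_sub, map_neg] at h2
    rw [h1]
    linear_combination h2
  · intro z
    have h1 : ‖fderiv ℝ (fun w : ℂ => (e.symm w).re - w.re) z‖ ≤ 2 * c :=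
      norm_fderiv_le_of_lip' ℝ (by positivity) (Eventually.of_forall fun w =>
        (Complex.abs_re_le_norm (e.symm w - w - (e.symm z - z))).trans (hsymlip w z))
    have h2 : ‖fderiv ℝ (fun w : ℂ => (e.symm w).im - w.im) z‖ ≤ 2 * c :=
      norm_fderiv_le_of_lip' ℝ (by positivity) (Eventually.of_forall fun w =>
        (Complex.abs_im_le_norm (e.symm w - w - (e.symm z - z))).trans (hsymlip w z))
    linarith

lemma norm_exp_neg_mul_I_le_one {k : ℝ} (hk : 0 ≤ k) {z : ℂ} (hz : z.im ≤ 0) :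
    ‖Complex.exp (-(k * z * Complex.I))‖ ≤ 1 := by
  rw [Complex.norm_exp, Real.exp_le_one_iff]
  simpa using mul_nonpos_of_nonneg_of_nonpos hk hz

lemma norm_exp_neg_mul_I_sub_le {k : ℝ} (hk : 0 ≤ k) {z w : ℂ} (hz : z.im ≤ 0)
    (hw : w.im ≤ 0) :
    ‖Complex.exp (-(k * z * Complex.I)) - Complex.exp (-(k * w * Complex.I))‖ ≤
      k * ‖z - w‖ := by
  refine (convex_halfSpace_im_le 0).norm_image_sub_le_of_norm_hasDerivWithin_le
    (f := fun z : ℂ => Complex.exp (-(k * z * Complex.I)))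
    (f' := fun z : ℂ => Complex.exp (-(k * z * Complex.I)) * -(k * Complex.I))
    (fun v _ => ?_) (fun v hv => ?_) hw hz
  · have h : HasDerivAt (fun z : ℂ => -(k * z * Complex.I)) (-(k * Complex.I)) v := by
      simpa using ((((hasDerivAt_id v).const_mul (k : ℂ)).mul_const Complex.I).fun_neg)
    exact h.cexp.hasDerivWithinAt
  · rw [norm_mul, norm_neg, norm_mul, Complex.norm_I, mul_one, Complex.norm_real,
      Real.norm_of_nonneg hk]
    exact mul_le_of_le_one_left hk (norm_exp_neg_mul_I_le_one hk hv)

/-- The holomorphic function on the lower half-plane whose boundary values have imaginary part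
`α + ∑ aⱼ cos ((j + 1) x)` and real part `∑ aⱼ sin ((j + 1) x)`. -/
def halfPlaneSeries (α : ℝ) (a : ℕ → ℝ) (z : ℂ) : ℂ :=
  Complex.I * (α + ∑' j : ℕ, (a j : ℂ) * Complex.exp (-(((j + 1 : ℝ) : ℂ) * z * Complex.I)))

section halfPlaneSeries

variable {a : ℕ → ℝ}

lemma norm_coeff_mul_exp_le (a : ℕ → ℝ) {z : ℂ} (hz : z.im ≤ 0) (j : ℕ) :
    ‖(a j : ℂ) * Complex.exp (-(((j + 1 : ℝ) : ℂ) * z * Complex.I))‖ ≤ |a j| := by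
  rw [norm_mul, Complex.norm_real]
  exact mul_le_of_le_one_right (norm_nonneg _) (norm_exp_neg_mul_I_le_one (by positivity) hz)

lemma summable_coeff_mul_exp (ha : Summable fun j => |a j|) {z : ℂ} (hz : z.im ≤ 0) :
    Summable fun j : ℕ => (a j : ℂ) * Complex.exp (-(((j + 1 : ℝ) : ℂ) * z * Complex.I)) :=
  Summable.of_norm_bounded ha (norm_coeff_mul_exp_le a hz)

lemma norm_halfPlaneSeries_le (ha : Summable fun j => |a j|) (α : ℝ) {z : ℂ} (hz : z.im ≤ 0) :
    ‖halfPlaneSeries α a z‖ ≤ |α| + ∑' j, |a j| := by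
  rw [halfPlaneSeries, norm_mul, Complex.norm_I, one_mul]
  refine (norm_add_le _ _).trans (add_le_add (Complex.norm_real α).le ?_)
  exact tsum_of_norm_bounded ha.hasSum (norm_coeff_mul_exp_le a hz)

lemma norm_halfPlaneSeries_sub_le (ha : Summable fun j => |a j|)
    (ha' : Summable fun j : ℕ => (j + 1 : ℝ) * |a j|) (α : ℝ) {z w : ℂ} (hz : z.im ≤ 0)
    (hw : w.im ≤ 0) :
    ‖halfPlaneSeries α a z - halfPlaneSeries α a w‖ ≤
      (∑' j : ℕ, (j + 1 : ℝ) * |a j|) * ‖z - w‖ := by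
  rw [halfPlaneSeries, halfPlaneSeries, ← mul_sub, norm_mul, Complex.norm_I, one_mul,
    add_sub_add_left_eq_sub,
    ← (summable_coeff_mul_exp ha hz).tsum_sub (summable_coeff_mul_exp ha hw)]
  refine tsum_of_norm_bounded (ha'.hasSum.mul_right _) fun j => ?_
  rw [← mul_sub, norm_mul, Complex.norm_real, Real.norm_eq_abs, mul_comm (j + 1 : ℝ),
    mul_assoc |a j|]
  exact mul_le_mul_of_nonneg_left (norm_exp_neg_mul_I_sub_le (by positivity) hz hw)
    (abs_nonneg _)

lemma differentiableOn_halfPlaneSeries (ha : Summable fun j => |a j|) (α : ℝ) :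
    DifferentiableOn ℂ (halfPlaneSeries α a) {w : ℂ | w.im < 0} := by
  have h : DifferentiableOn ℂ (fun z : ℂ =>
      ∑' j : ℕ, (a j : ℂ) * Complex.exp (-(((j + 1 : ℝ) : ℂ) * z * Complex.I)))
      {w : ℂ | w.im < 0} :=
    Complex.differentiableOn_tsum_of_summable_norm ha
      (fun j => Differentiable.differentiableOn (by fun_prop))
      (isOpen_lt Complex.continuous_im continuous_const)
      (fun j w hw => norm_coeff_mul_exp_le a (le_of_lt hw) j)
  exact (h.const_add (α : ℂ)).const_mul Complex.I

lemma halfPlaneSeries_add_two_pi (α : ℝ) (a : ℕ → ℝ) (z : ℂ) :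
    halfPlaneSeries α a (z + (2 * Real.pi : ℝ)) = halfPlaneSeries α a z := by
  rw [halfPlaneSeries, halfPlaneSeries]
  congr 2
  refine tsum_congr fun j => ?_
  congr 1
  refine Complex.exp_eq_exp_iff_exists_int.2 ⟨-(j + 1 : ℤ), ?_⟩
  push_cast
  ring

lemma halfPlaneSeries_neg_conj (α : ℝ) (a : ℕ → ℝ) (z : ℂ) :
    halfPlaneSeries α a (-(starRingEnd ℂ) z) = -(starRingEnd ℂ) (halfPlaneSeries α a z) := by
  rw [halfPlaneSeries, halfPlaneSeries, map_mul, Complex.conj_I, neg_mul, neg_neg, map_add,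
    Complex.conj_ofReal, Complex.conj_tsum]
  congr 2
  refine tsum_congr fun j => ?_
  rw [map_mul, Complex.conj_ofReal, ← Complex.exp_conj]
  simp

lemma halfPlaneSeries_ofReal (ha : Summable fun j => |a j|) (α s : ℝ) :
    (halfPlaneSeries α a s).re = ∑' j : ℕ, a j * Real.sin ((j + 1 : ℝ) * s) ∧
      (halfPlaneSeries α a s).im = α + ∑' j : ℕ, a j * Real.cos ((j + 1 : ℝ) * s) := by
  have hs := summable_coeff_mul_exp ha (z := s) (by simp)
  have e : ∀ j : ℕ, (a j : ℂ) * Complex.exp (-(((j + 1 : ℝ) : ℂ) * s * Complex.I)) =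
      ⟨a j * Real.cos ((j + 1 : ℝ) * s), -(a j * Real.sin ((j + 1 : ℝ) * s))⟩ := by
    intro j
    rw [← neg_mul, Complex.exp_mul_I, Complex.cos_neg, Complex.sin_neg, ← Complex.ofReal_mul,
      ← Complex.ofReal_cos, ← Complex.ofReal_sin]
    apply Complex.ext <;> simp only [Complex.re_ofReal_mul, Complex.im_ofReal_mul,
      Complex.add_re, Complex.add_im, neg_mul, Complex.neg_re, Complex.neg_im,
      Complex.re_ofReal_mul, Complex.im_ofReal_mul, Complex.ofReal_re, Complex.ofReal_im,
      Complex.I_re, Complex.I_im] <;> ring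
  have hre := Complex.re_tsum hs
  have him := Complex.im_tsum hs
  simp only [e] at hre him
  rw [tsum_neg] at him
  simp only [halfPlaneSeries, Complex.I_mul_re, Complex.I_mul_im, Complex.add_re,
    Complex.add_im, Complex.ofReal_re, Complex.ofReal_im, e, hre, him, zero_add, neg_neg,
    and_self]

end halfPlaneSeries

/-- existence of a Riemann mapping flattening the free surface. There are
`ε₀, C > 0` such that for every `0 < ε ≤ ε₀` and every C^∞, even, 2π-periodic `η` with
`|η^{(j)}| ≤ ε` for `0 ≤ j ≤ 5`, there is `Z = Z₁ + iZ₂`, continuous on the closure of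
`Ω = {x+iy : y < η(x)}` and holomorphic on `Ω`, such that: (i) `Z` maps `Ω` bijectively
onto the open lower half-plane; (ii) `Z₂(x+iη(x)) = 0`; (iii) `Z(z+2π) = Z(z)+2π`;
(iv) `Z(−conj z) = −conj(Z z)`; (v) `|∇(Z₁−x)| + |∇(Z₂−y)| ≤ C·ε` on `Ω`. -/
theorem statement14 :
    ∃ ε₀ C : ℝ, 0 < ε₀ ∧ 0 < C ∧
      ∀ (ε : ℝ) (η : ℝ → ℝ), 0 < ε → ε ≤ ε₀ →
        ContDiff ℝ (⊤ : ℕ∞) η →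
        (∀ x : ℝ, η (-x) = η x) →
        Function.Periodic η (2 * Real.pi) →
        (∀ j : ℕ, j ≤ 5 → ∀ x : ℝ, |iteratedDeriv j η x| ≤ ε) →
        ∃ Z : ℂ → ℂ,
          ContinuousOn Z (closure (fluidDomain η)) ∧
          DifferentiableOn ℂ Z (fluidDomain η) ∧
          -- (i) bijection onto the open lower half-plane
          Set.BijOn Z (fluidDomain η) {w : ℂ | w.im < 0} ∧
          -- (ii) the free surface is sent to the real axis
          (∀ x : ℝ, (Z ((x : ℂ) + (η x : ℂ) * Complex.I)).im = 0) ∧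
          -- (iii) 2π-periodicity
          (∀ z ∈ fluidDomain η, Z (z + (2 * Real.pi : ℝ)) = Z z + (2 * Real.pi : ℝ)) ∧
          -- (iv) Z₁ odd and Z₂ even in x
          (∀ z ∈ fluidDomain η, Z (-(starRingEnd ℂ) z) = -(starRingEnd ℂ) (Z z)) ∧
          -- (v) gradient bounds for Z₁ − x and Z₂ − y
          (∀ z ∈ fluidDomain η,
            ‖fderiv ℝ (fun w : ℂ => (Z w).re - w.re) z‖ +
              ‖fderiv ℝ (fun w : ℂ => (Z w).im - w.im) z‖ ≤ C * ε) := by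
  refine ⟨1 / 40, 72, by norm_num, by norm_num, ?_⟩
  intro ε η hε hε' hη heven hper hb
  have hη0 : Continuous η := hη.continuous
  have h1 : ∀ x, HasDerivAt η (iteratedDeriv 1 η x) x := fun x => by
    rw [iteratedDeriv_one]
    exact (hη.differentiable (by simp) x).hasDerivAt
  have h2 : ∀ x, HasDerivAt (iteratedDeriv 1 η) (iteratedDeriv 2 η x) x := fun x => by
    rw [show iteratedDeriv 2 η = deriv (iteratedDeriv 1 η) from iteratedDeriv_succ]
    exact (hη.differentiable_iteratedDeriv 1
      (by exact_mod_cast ENat.natCast_lt_top 1) x).hasDerivAt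
  have hc2 : Continuous (iteratedDeriv 2 η) :=
    hη.continuous_iteratedDeriv 2 (WithTop.coe_le_coe.2 (le_top : ((2 : ℕ) : ℕ∞) ≤ ⊤))
  have hodd : ∀ x, deriv η (-x) = -deriv η x := by
    intro x
    have := deriv_comp_neg η x
    simp only [heven] at this
    linarith
  have hd0 : iteratedDeriv 1 η 0 = 0 := by
    rw [iteratedDeriv_one]
    have := hodd 0
    rw [neg_zero] at this
    linarith
  have hdpi : iteratedDeriv 1 η Real.pi = 0 := by
    rw [iteratedDeriv_one]
    have h3 : deriv η (-Real.pi + 2 * Real.pi) = deriv η (-Real.pi) := by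
      rw [← deriv_comp_add_const]
      congr 1
      exact funext hper
    rw [hodd, show -Real.pi + 2 * Real.pi = Real.pi by ring] at h3
    linarith
  have hb0 : ∀ x, |η x| ≤ ε := fun x => by simpa using hb 0 (by norm_num) x
  obtain ⟨α, a, hS, hSle, ha⟩ := exists_conjugate_coeffs h1 h2 hc2 hd0 hdpi hε.le hε' hb0
    (hb 1 (by norm_num)) (hb 2 (by norm_num)) heven hper
  have hSa : Summable fun j => |a j| := Summable.of_nonneg_of_le (fun j => abs_nonneg _)
    (fun j => le_mul_of_one_le_left (abs_nonneg _) (by simp)) hS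
  obtain ⟨Z, hZ, hZd, hbij, hsurf, hZper, hsym, hgrad⟩ :=
    exists_flattening_of_perturbation hη0 (f := halfPlaneSeries α a) (c := 18 * ε)
      (by positivity) (by linarith)
      (fun z w hz hw => (norm_halfPlaneSeries_sub_le hSa hS α hz hw).trans
        (mul_le_mul_of_nonneg_right hSle (norm_nonneg _)))
      (fun z hz => norm_halfPlaneSeries_le hSa α hz) hb0
      (differentiableOn_halfPlaneSeries hSa α)
      (fun s => by
        rw [(halfPlaneSeries_ofReal hSa α s).1, (halfPlaneSeries_ofReal hSa α s).2,
          (ha s).tsum_eq]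
        ring)
      (fun z _ => halfPlaneSeries_add_two_pi α a z) (fun z _ => halfPlaneSeries_neg_conj α a z)
  refine ⟨Z, hZ.continuousOn, hZd, hbij, hsurf, fun z _ => hZper z, fun z _ => hsym z,
    fun z _ => (hgrad z).trans (le_of_eq ?_)⟩
  ring
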